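/- (DT-DOI tightness.) The optimal value of the Detour-DOI LP equals the optimal value of the set-cover master LP, assuming the column set Ω is closed under the following operation: for any l ∈ Ω and any subset N̂ of items such that for every demand d the number of items in N̂ with demand ≥ d is at most D_{dl}, there is a column l* ∈ Ω covering exactly N̂ with c_{l*} ≤ c_l + Σ_{u ∈ N̂} c_{ul}. -/

import Mathlib

open Finset

variable {N Ω : Type*} [Fintype N] [Fintype Ω]

/-- Feasibility for the set-cover master LP for CVRP. -/
def MasterFeas (a : N → Ω → ℝ) (K : ℝ) (θ : Ω → ℝ) : Prop :=
  (∀ l, 0 ≤ θ l) ∧ (∀ u, 1 ≤ ∑ l, a u l * θ l) ∧ (∑ l, θ l) ≤ K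

/-- Feasibility for the Detour-DOI LP.  Here `D_{dl} = Σ_u [d ≤ d_u] a_{ul}`. -/
def DTFeas (a : N → Ω → ℝ) (du : N → ℕ) (Dset : Finset ℕ) (K : ℝ)
    (θ ψ : Ω → ℝ) (y : N → Ω → ℝ) : Prop :=
  (∀ l, 0 ≤ θ l) ∧ (∀ l, 0 ≤ ψ l) ∧ (∀ u l, 0 ≤ y u l) ∧
  (∀ u, 1 ≤ (∑ l, y u l) + ∑ l, a u l * θ l) ∧
  (∀ u l, y u l ≤ ψ l) ∧
  (∀ l, ∀ d ∈ Dset,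
    (∑ u, if d ≤ du u then y u l else 0) ≤ (∑ u, if d ≤ du u then a u l else 0) * ψ l) ∧
  (∑ l, θ l) + (∑ l, ψ l) ≤ K

/-- Objective of the Detour-DOI LP. -/
def DTObj (c : Ω → ℝ) (cul : N → Ω → ℝ) (θ ψ : Ω → ℝ) (y : N → Ω → ℝ) : ℝ :=
  (∑ l, c l * θ l) + (∑ l, c l * ψ l) + ∑ u, ∑ l, cul u l * y u l

/-- A sum of reals that are integers is an integer. -/
theorem exists_int_eq_sum {ι : Type*} (s : Finset ι) (f : ι → ℝ)
    (hf : ∀ i ∈ s, ∃ n : ℤ, f i = n) : ∃ n : ℤ, ∑ i ∈ s, f i = n := by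
  choose! g hg using hf
  exact ⟨∑ i ∈ s, g i, by rw [Int.cast_sum]; exact sum_congr rfl hg⟩

/-- The points of the unit cube whose sums over the demand thresholds `d ∈ Dset`
are bounded by `b d`. -/
def thresholdPolytope (du : N → ℕ) (Dset : Finset ℕ) (b : ℕ → ℝ) : Set (N → ℝ) :=
  {x | (∀ u, x u ∈ Set.Icc (0 : ℝ) 1) ∧ ∀ d ∈ Dset, (∑ u, if d ≤ du u then x u else 0) ≤ b d}

theorem convex_thresholdPolytope (du : N → ℕ) (Dset : Finset ℕ) (b : ℕ → ℝ) :
    Convex ℝ (thresholdPolytope du Dset b) := by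
  intro x hx y hy s t hs ht hst
  refine ⟨fun u => convex_Icc (0 : ℝ) 1 (hx.1 u) (hy.1 u) hs ht hst, fun d hd => ?_⟩
  have h : (∑ u, if d ≤ du u then (s • x + t • y) u else 0) =
      s * (∑ u, if d ≤ du u then x u else 0) + t * ∑ u, if d ≤ du u then y u else 0 := by
    rw [mul_sum, mul_sum, ← sum_add_distrib]
    refine sum_congr rfl fun u _ => ?_
    split_ifs <;> simp
  rw [h]
  calc _ ≤ s * b d + t * b d :=
        add_le_add (mul_le_mul_of_nonneg_left (hx.2 d hd) hs)
          (mul_le_mul_of_nonneg_left (hy.2 d hd) ht)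
    _ = b d := by rw [← add_mul, hst, one_mul]

theorem isCompact_thresholdPolytope (du : N → ℕ) (Dset : Finset ℕ) (b : ℕ → ℝ) :
    IsCompact (thresholdPolytope du Dset b) := by
  have hcube : IsCompact (Set.univ.pi fun _ : N => Set.Icc (0 : ℝ) 1) :=
    isCompact_univ_pi fun _ => isCompact_Icc
  have hclosed : IsClosed
      {x : N → ℝ | ∀ d ∈ Dset, (∑ u, if d ≤ du u then x u else 0) ≤ b d} := by
    simp only [Set.ofPred_forall]
    refine isClosed_biInter fun d _ => isClosed_le ?_ continuous_const
    refine continuous_finsetSum _ fun u _ => ?_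
    split_ifs <;> fun_prop
  convert hcube.inter_right hclosed using 1
  ext x
  simp [thresholdPolytope, Pi.le_def, forall_and]

/-- A direction that only moves fractional coordinates and non-tight threshold sums
vanishes at an extreme point. -/
theorem eq_zero_of_mem_extremePoints_thresholdPolytope {du : N → ℕ} {Dset : Finset ℕ}
    {b : ℕ → ℝ} {x : N → ℝ} (hx : x ∈ (thresholdPolytope du Dset b).extremePoints ℝ)
    (g : N → ℝ) (hg : ∀ u, g u = 0 ∨ x u ∈ Set.Ioo (0 : ℝ) 1)
    (hsum : ∀ d ∈ Dset, (∑ u, if d ≤ du u then g u else 0) = 0 ∨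
      (∑ u, if d ≤ du u then x u else 0) < b d) : g = 0 := by
  have hmem : ∀ᶠ ε : ℝ in nhds 0, x + ε • g ∈ thresholdPolytope du Dset b := by
    have hbox : ∀ᶠ ε : ℝ in nhds 0, ∀ u, (x + ε • g) u ∈ Set.Icc (0 : ℝ) 1 := by
      refine Filter.eventually_all.2 fun u => ?_
      rcases hg u with h | h
      · exact .of_forall fun ε => by simpa [h] using hx.1.1 u
      · have hc : Continuous fun ε : ℝ => (x + ε • g) u := by
          simp only [Pi.add_apply, Pi.smul_apply]; fun_prop
        refine (hc.tendsto 0).eventually (Icc_mem_nhds ?_ ?_)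
        · simpa using h.1
        · simpa using h.2
    have hthr : ∀ᶠ ε : ℝ in nhds 0, ∀ d ∈ Dset,
        (∑ u, if d ≤ du u then (x + ε • g) u else 0) ≤ b d := by
      refine (Filter.eventually_all_finset Dset).2 fun d hd => ?_
      have heq : ∀ ε : ℝ, (∑ u, if d ≤ du u then (x + ε • g) u else 0) =
          (∑ u, if d ≤ du u then x u else 0) + ε * ∑ u, if d ≤ du u then g u else 0 := by
        intro ε
        rw [mul_sum, ← sum_add_distrib]
        refine sum_congr rfl fun u _ => ?_
        split_ifs <;> simp
      simp only [heq]
      rcases hsum d hd with h | h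
      · exact .of_forall fun ε => by simpa [h] using hx.1.2 d hd
      · have hc : Continuous fun ε : ℝ => (∑ u, if d ≤ du u then x u else 0) +
            ε * ∑ u, if d ≤ du u then g u else 0 := by fun_prop
        refine (hc.tendsto 0).eventually (Iic_mem_nhds ?_)
        simpa using h
    filter_upwards [hbox, hthr] with ε h₁ h₂ using ⟨h₁, h₂⟩
  obtain ⟨δ, hδ, hball⟩ := Metric.eventually_nhds_iff.1 hmem
  have hpos : x + (δ / 2) • g ∈ thresholdPolytope du Dset b :=
    hball (by rw [dist_zero_right, Real.norm_eq_abs, abs_of_pos] <;> linarith)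
  have hneg : x + (-(δ / 2)) • g ∈ thresholdPolytope du Dset b :=
    hball (by rw [dist_zero_right, norm_neg, Real.norm_eq_abs, abs_of_pos] <;> linarith)
  have hseg : x ∈ openSegment ℝ (x + (δ / 2) • g) (x + (-(δ / 2)) • g) :=
    ⟨1 / 2, 1 / 2, by norm_num, by norm_num, by norm_num, by ext u; simp; ring⟩
  have := hx.2 hpos hneg hseg
  simpa [hδ.ne'] using this

/-- A threshold sum with exactly one fractional coordinate is not tight. -/
theorem sum_lt_of_unique_fractional {du : N → ℕ} {Dset : Finset ℕ}
    {b : ℕ → ℝ} (hb : ∀ d ∈ Dset, ∃ n : ℤ, b d = n) {x : N → ℝ}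
    (hx : x ∈ thresholdPolytope du Dset b) {d : ℕ} (hd : d ∈ Dset) {u : N}
    (hu : x u ∈ Set.Ioo (0 : ℝ) 1) (hdu : d ≤ du u)
    (huniq : ∀ v, v ≠ u → d ≤ du v → x v ∉ Set.Ioo (0 : ℝ) 1) :
    (∑ v, if d ≤ du v then x v else 0) < b d := by
  classical
  refine lt_of_le_of_ne (hx.2 d hd) fun heq => ?_
  obtain ⟨m, hm⟩ := exists_int_eq_sum (univ.erase u) (fun v => if d ≤ du v then x v else 0) (by
    intro v hv
    split_ifs with h
    · have hmem := huniq v (ne_of_mem_erase hv) h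
      rcases (hx.1 v).1.eq_or_lt with h₀ | h₀
      · exact ⟨0, by simp [← h₀]⟩
      · rcases (hx.1 v).2.eq_or_lt with h₁ | h₁
        · exact ⟨1, by simp [h₁]⟩
        · exact absurd ⟨h₀, h₁⟩ hmem
    · exact ⟨0, by simp⟩)
  obtain ⟨n, hn⟩ := hb d hd
  rw [← add_sum_erase _ _ (mem_univ u), hm, hn, if_pos hdu] at heq
  have h₀ : (0 : ℝ) < ((n - m : ℤ) : ℝ) := by push_cast; linarith [hu.1]
  have h₁ : ((n - m : ℤ) : ℝ) < ((1 : ℤ) : ℝ) := by push_cast; linarith [hu.2]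
  have h₀' : 0 < n - m := by exact_mod_cast h₀
  have h₁' : n - m < 1 := by exact_mod_cast h₁
  omega

/-- Threshold polytopes with integral bounds are integral. -/
theorem eq_zero_or_one_of_mem_extremePoints_thresholdPolytope {du : N → ℕ} {Dset : Finset ℕ}
    {b : ℕ → ℝ} (hb : ∀ d ∈ Dset, ∃ n : ℤ, b d = n) {x : N → ℝ}
    (hx : x ∈ (thresholdPolytope du Dset b).extremePoints ℝ) (w : N) : x w = 0 ∨ x w = 1 := by
  classical
  by_contra! hw
  have hwF : x w ∈ Set.Ioo (0 : ℝ) 1 :=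
    ⟨(hx.1.1 w).1.lt_of_ne hw.1.symm, (hx.1.1 w).2.lt_of_ne hw.2⟩
  obtain ⟨u, hu, humax⟩ := exists_max_image (univ.filter fun v => x v ∈ Set.Ioo (0 : ℝ) 1) du
    ⟨w, by simpa using hwF⟩
  rw [mem_filter_univ] at hu
  have hsingle : ∀ (d : ℕ) (v : N),
      (∑ i, if d ≤ du i then (Pi.single v (1 : ℝ) : N → ℝ) i else 0) =
        if d ≤ du v then 1 else 0 := by
    intro d v
    rw [sum_eq_single v] <;> simp +contextual
  by_cases hF : ((univ.filter fun v => x v ∈ Set.Ioo (0 : ℝ) 1).erase u).Nonempty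
  · obtain ⟨v, hv, hvmax⟩ := exists_max_image _ du hF
    obtain ⟨hvu, hv⟩ := mem_erase.1 hv
    have hle := humax v hv
    rw [mem_filter_univ] at hv
    have h0 := eq_zero_of_mem_extremePoints_thresholdPolytope hx
      (Pi.single u 1 - Pi.single v 1) (fun i => by
        by_cases hi : i = u
        · exact .inr (hi ▸ hu)
        · by_cases hi' : i = v
          · exact .inr (hi' ▸ hv)
          · exact .inl (by simp [hi, hi'])) (fun d hd => by
        have hsub : (∑ i, if d ≤ du i then
            (Pi.single u (1 : ℝ) - Pi.single v 1 : N → ℝ) i else 0) =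
            (if d ≤ du u then 1 else 0) - if d ≤ du v then 1 else 0 := by
          rw [← hsingle, ← hsingle, ← sum_sub_distrib]
          refine sum_congr rfl fun i _ => ?_
          split_ifs <;> simp
        rw [hsub]
        by_cases h₁ : d ≤ du u
        · by_cases h₂ : d ≤ du v
          · simp [h₁, h₂]
          · refine .inr (sum_lt_of_unique_fractional hb hx.1 hd hu h₁ fun i hi hdi hif => ?_)
            exact h₂ (hdi.trans (hvmax i (mem_erase.2 ⟨hi, by simpa using hif⟩)))
        · have h₂ : ¬ d ≤ du v := fun h => h₁ (h.trans hle)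
          simp [h₁, h₂])
    have := congrFun h0 u
    simp [hvu.symm] at this
  · have h0 := eq_zero_of_mem_extremePoints_thresholdPolytope hx (Pi.single u 1) (fun i => by
        by_cases hi : i = u
        · exact .inr (hi ▸ hu)
        · exact .inl (by simp [hi])) (fun d hd => by
        rw [hsingle]
        by_cases h₁ : d ≤ du u
        · refine .inr (sum_lt_of_unique_fractional hb hx.1 hd hu h₁ fun i hi _ hif => ?_)
          exact hF ⟨i, mem_erase.2 ⟨hi, by simpa using hif⟩⟩
        · simp [h₁])
    have := congrFun h0 u
    simp at this

/-- Threshold polytopes with integral bounds are the convex hulls of their extreme points. -/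
theorem convexHull_extremePoints_thresholdPolytope {du : N → ℕ} {Dset : Finset ℕ}
    {b : ℕ → ℝ} (hb : ∀ d ∈ Dset, ∃ n : ℤ, b d = n) :
    convexHull ℝ ((thresholdPolytope du Dset b).extremePoints ℝ) =
      thresholdPolytope du Dset b := by
  have hfin : ((thresholdPolytope du Dset b).extremePoints ℝ).Finite := by
    refine (Set.Finite.pi' (t := fun _ : N => ({0, 1} : Set ℝ)) fun _ =>
      Set.toFinite _).subset fun x hx u => ?_
    simpa using eq_zero_or_one_of_mem_extremePoints_thresholdPolytope hb hx u
  rw [← (hfin.isCompact_convexHull (𝕜 := ℝ)).isClosed.closure_eq]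
  exact closure_convexHull_extremePoints (isCompact_thresholdPolytope du Dset b)
    (convex_thresholdPolytope du Dset b)

/-- Under the closure property, every point of the threshold polytope of a column `l` is the
coverage of a probability vector on columns whose cost is at most the detour cost. -/
theorem exists_columns_of_mem_thresholdPolytope [DecidableEq N] {c : Ω → ℝ} {cul : N → Ω → ℝ}
    {a : N → Ω → ℝ} {du : N → ℕ} {Dset : Finset ℕ} (ha : ∀ u l, a u l = 0 ∨ a u l = 1) {l : Ω}
    (hclosed : ∀ Nhat : Finset N,
      (∀ d ∈ Dset, ((Nhat.filter fun u => d ≤ du u).card : ℝ) ≤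
        ∑ u, if d ≤ du u then a u l else 0) →
      ∃ lstar : Ω, (∀ u, a u lstar = if u ∈ Nhat then 1 else 0) ∧
        c lstar ≤ c l + ∑ u ∈ Nhat, cul u l)
    {x : N → ℝ}
    (hx : x ∈ thresholdPolytope du Dset fun d => ∑ u, if d ≤ du u then a u l else 0) :
    ∃ φ : Ω → ℝ, (∀ k, 0 ≤ φ k) ∧ (∑ k, φ k = 1) ∧ (∀ u, ∑ k, a u k * φ k = x u) ∧
      ∑ k, c k * φ k ≤ c l + ∑ u, cul u l * x u := by
  classical
  have hb : ∀ d ∈ Dset, ∃ n : ℤ, (∑ u, if d ≤ du u then a u l else 0) = (n : ℝ) := by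
    refine fun d _ => exists_int_eq_sum _ _ fun u _ => ?_
    split_ifs
    · rcases ha u l with h | h
      · exact ⟨0, by simp [h]⟩
      · exact ⟨1, by simp [h]⟩
    · exact ⟨0, by simp⟩
  let G : Set (N → ℝ) := {x | ∃ φ : Ω → ℝ, (∀ k, 0 ≤ φ k) ∧ (∑ k, φ k = 1) ∧
    (∀ u, ∑ k, a u k * φ k = x u) ∧ ∑ k, c k * φ k ≤ c l + ∑ u, cul u l * x u}
  have hG : Convex ℝ G := by
    rintro x ⟨φ, hφ, hφ₁, hφx, hφc⟩ y ⟨χ, hχ, hχ₁, hχy, hχc⟩ s t hs ht hst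
    have hlin : ∀ {ι : Type _} [Fintype ι] (f p q : ι → ℝ),
        ∑ k, f k * (s * p k + t * q k) = s * ∑ k, f k * p k + t * ∑ k, f k * q k := by
      intro ι _ f p q
      rw [mul_sum, mul_sum, ← sum_add_distrib]
      exact sum_congr rfl fun k _ => by ring
    have hlin' : ∑ u, cul u l * (s * x u + t * y u) =
        s * ∑ u, cul u l * x u + t * ∑ u, cul u l * y u := by
      rw [mul_sum, mul_sum, ← sum_add_distrib]
      exact sum_congr rfl fun k _ => by ring
    refine ⟨fun k => s * φ k + t * χ k, fun k => ?_, ?_, fun u => ?_, ?_⟩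
    · have := hφ k
      have := hχ k
      positivity
    · rw [sum_add_distrib, ← mul_sum, ← mul_sum, hφ₁, hχ₁, mul_one, mul_one, hst]
    · rw [hlin, hφx, hχy]; simp
    · simp only [Pi.add_apply, Pi.smul_apply, smul_eq_mul]
      rw [hlin, hlin']
      calc _ ≤ s * (c l + ∑ u, cul u l * x u) + t * (c l + ∑ u, cul u l * y u) :=
            add_le_add (mul_le_mul_of_nonneg_left hφc hs) (mul_le_mul_of_nonneg_left hχc ht)
        _ = (s + t) * c l + (s * ∑ u, cul u l * x u + t * ∑ u, cul u l * y u) := by ring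
        _ = _ := by rw [hst, one_mul]
  rw [← convexHull_extremePoints_thresholdPolytope hb] at hx
  refine convexHull_min (fun p hp => ?_) hG hx
  have hp01 := eq_zero_or_one_of_mem_extremePoints_thresholdPolytope hb hp
  have hind : ∀ u, p u = if u ∈ univ.filter (fun v => p v = 1) then 1 else 0 := by
    intro u
    rcases hp01 u with h | h <;> simp [h]
  obtain ⟨k, hk, hck⟩ := hclosed (univ.filter fun u => p u = 1) (fun d hd => by
    refine le_of_eq_of_le ?_ (hp.1.2 d hd)
    rw [filter_filter, card_filter, Nat.cast_sum]
    refine sum_congr rfl fun u _ => ?_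
    rcases hp01 u with h | h <;> simp [h])
  refine ⟨Pi.single k 1, fun j => ?_, by simp, fun u => ?_, ?_⟩
  · by_cases h : j = k
    · subst h; simp
    · simp [h]
  · rw [hind u, ← hk u]
    simp [Pi.single_apply]
  · convert hck using 1
    · simp [Pi.single_apply]
    · congr 1
      rw [sum_filter]
      refine sum_congr rfl fun u _ => ?_
      rcases hp01 u with h | h <;> simp [h]

/-- DT-DOI tightness: if the column set is closed under the operation of
replacing a column `l` by a column `l*` covering exactly any item set `N̂`
whose demand-threshold counts are dominated by those of `l`, at cost at most
`c_l + Σ_{u ∈ N̂} c_{ul}`, then the Detour-DOI LP and the set-cover master LP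
have equal optimal values. -/
theorem stmt10 [DecidableEq N] (c : Ω → ℝ) (cul : N → Ω → ℝ) (a : N → Ω → ℝ)
    (du : N → ℕ) (Dset : Finset ℕ) (K : ℝ)
    (hc : ∀ l, 0 ≤ c l) (hcul : ∀ u l, 0 ≤ cul u l)
    (ha : ∀ u l, a u l = 0 ∨ a u l = 1) (hdu : ∀ u, du u ∈ Dset)
    (hclosed : ∀ l : Ω, ∀ Nhat : Finset N,
      (∀ d ∈ Dset, ((Nhat.filter fun u => d ≤ du u).card : ℝ) ≤
        ∑ u, if d ≤ du u then a u l else 0) →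
      ∃ lstar : Ω, (∀ u, a u lstar = if u ∈ Nhat then 1 else 0) ∧
        c lstar ≤ c l + ∑ u ∈ Nhat, cul u l)
    (hfeas : ∃ θ, MasterFeas a K θ) :
    sInf {z : ℝ | ∃ θ ψ y, DTFeas a du Dset K θ ψ y ∧ z = DTObj c cul θ ψ y} =
      sInf {z : ℝ | ∃ θ, MasterFeas a K θ ∧ z = ∑ l, c l * θ l} := by
  have hnn : ∀ θ, MasterFeas a K θ → 0 ≤ ∑ l, c l * θ l := fun θ h =>
    sum_nonneg fun l _ => mul_nonneg (hc l) (h.1 l)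
  obtain ⟨θ₀, hθ₀⟩ := hfeas
  have hembed : ∀ θ, MasterFeas a K θ → DTFeas a du Dset K θ 0 0 ∧
      ∑ l, c l * θ l = DTObj c cul θ 0 0 := by
    rintro θ ⟨h₁, h₂, h₃⟩
    exact ⟨⟨h₁, by simp, by simp, by simpa using h₂, by simp, by simp, by simpa using h₃⟩,
      by simp [DTObj]⟩
  apply le_antisymm
  · refine le_csInf ⟨_, θ₀, hθ₀, rfl⟩ ?_
    rintro z ⟨θ, hθ, rfl⟩
    refine csInf_le ⟨0, ?_⟩ ⟨θ, 0, 0, hembed θ hθ⟩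
    rintro z ⟨θ, ψ, y, ⟨h₁, h₂, h₃, -⟩, rfl⟩
    exact add_nonneg (add_nonneg (sum_nonneg fun l _ => mul_nonneg (hc l) (h₁ l))
      (sum_nonneg fun l _ => mul_nonneg (hc l) (h₂ l)))
      (sum_nonneg fun u _ => sum_nonneg fun l _ => mul_nonneg (hcul u l) (h₃ u l))
  · refine le_csInf ⟨_, θ₀, 0, 0, hembed θ₀ hθ₀⟩ ?_
    rintro z ⟨θ, ψ, y, ⟨hθ, hψ, hy, hcover, hyψ, hthr, hK⟩, rfl⟩
    have hcols : ∀ l, ∃ φ : Ω → ℝ, (∀ k, 0 ≤ φ k) ∧ (∑ k, φ k = ψ l) ∧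
        (∀ u, ∑ k, a u k * φ k = y u l) ∧
        ∑ k, c k * φ k ≤ c l * ψ l + ∑ u, cul u l * y u l := by
      intro l
      rcases (hψ l).eq_or_lt with h | h
      · have hy0 : ∀ u, y u l = 0 := fun u => le_antisymm (h ▸ hyψ u l) (hy u l)
        exact ⟨0, by simp, by simp [← h], by simp [hy0], by simp [hy0, ← h]⟩
      · obtain ⟨φ, h₁, h₂, h₃, h₄⟩ := exists_columns_of_mem_thresholdPolytope
          (x := fun u => y u l / ψ l) ha (hclosed l)
          ⟨fun u => ⟨div_nonneg (hy u l) h.le, (div_le_one h).2 (hyψ u l)⟩, fun d hd => by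
            refine le_of_eq_of_le ?_ ((div_le_iff₀ h).2 (hthr l d hd))
            rw [sum_div]
            exact sum_congr rfl fun u _ => by split_ifs <;> simp⟩
        have hscale : ∀ f : Ω → ℝ, ∑ k, f k * (ψ l * φ k) = ψ l * ∑ k, f k * φ k := by
          intro f
          rw [mul_sum]
          exact sum_congr rfl fun k _ => by ring
        refine ⟨fun k => ψ l * φ k, fun k => mul_nonneg h.le (h₁ k), ?_, fun u => ?_, ?_⟩
        · rw [← mul_sum, h₂, mul_one]
        · rw [hscale, h₃, mul_div_cancel₀ _ h.ne']
        · rw [hscale]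
          refine (mul_le_mul_of_nonneg_left h₄ h.le).trans_eq ?_
          rw [mul_add, mul_comm, mul_sum]
          congr 1
          exact sum_congr rfl fun u _ => by field_simp
    choose φ hφ hφψ hφy hφc using hcols
    have hsplit : ∀ f : Ω → ℝ, ∑ k, f k * (θ k + ∑ l, φ l k) =
        ∑ k, f k * θ k + ∑ l, ∑ k, f k * φ l k := by
      intro f
      rw [sum_comm, ← sum_add_distrib]
      exact sum_congr rfl fun k _ => by rw [mul_add, mul_sum]
    have hfeas' : MasterFeas a K fun k => θ k + ∑ l, φ l k := by
      refine ⟨fun k => add_nonneg (hθ k) (sum_nonneg fun l _ => hφ l k), fun u => ?_, ?_⟩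
      · rw [hsplit]
        simp only [hφy]
        linarith [hcover u]
      · rw [sum_add_distrib, sum_comm]
        simpa only [hφψ] using hK
    refine csInf_le_of_le ⟨0, ?_⟩ ⟨_, hfeas', rfl⟩ ?_
    · rintro z ⟨θ, h, rfl⟩
      exact hnn θ h
    · rw [hsplit, DTObj, add_assoc, sum_comm (f := fun u l => cul u l * y u l)]
      refine add_le_add le_rfl ?_
      rw [← sum_add_distrib]
      exact sum_le_sum fun l _ => hφc l
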